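/- Let (π, H) be a square-integrable σ-representation of a countable discrete group Γ on a separable complex Hilbert space H, and suppose (Γ, σ) satisfies Kleppner's condition. Then at least one of the following holds (possibly both): (a) there exists g ∈ H such that the closed linear span of {π(γ)g : γ ∈ Γ} equals H (a cyclic vector); (b) there exists g ∈ H that is separating for π(Γ)'', i.e., every T ∈ π(Γ)'' with Tg = 0 satisfies T = 0. -/

import Mathlib

open MeasureTheory
open scoped ENNReal ComplexInnerProductSpace

noncomputable section

section Defs

variable {Γ : Type*} [Group Γ] {H : Type*} [NormedAddCommGroup H] [InnerProductSpace ℂ H]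

/-- A projective unitary `σ`-representation: `|σ| = 1`, cocycle identity, normalization,
`π 1 = I`, and `π x π y = σ(x,y) π(xy)`. -/
def IsProjectiveRep (σ : Γ → Γ → ℂ) (π : Γ → H ≃ₗᵢ[ℂ] H) : Prop :=
  (∀ x y : Γ, ‖σ x y‖ = 1) ∧
  (∀ x y z : Γ, σ x (y * z) * σ y z = σ (x * y) z * σ x y) ∧
  (∀ x : Γ, σ x 1 = 1 ∧ σ 1 x = 1) ∧
  π 1 = LinearIsometryEquiv.refl ℂ H ∧
  ∀ x y : Γ, ∀ f : H, π x (π y f) = σ x y • π (x * y) f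

/-- `g` is a Bessel vector for the family `(π γ g)_γ`. -/
def IsBesselVector (π : Γ → H ≃ₗᵢ[ℂ] H) (g : H) : Prop :=
  ∃ B : ℝ, 0 < B ∧ ∀ f : H,
    (Summable fun γ : Γ => ‖⟪f, π γ g⟫‖ ^ 2) ∧
      (∑' γ : Γ, ‖⟪f, π γ g⟫‖ ^ 2) ≤ B * ‖f‖ ^ 2

/-- Square-integrability: square-summable matrix coefficients on a dense subspace. -/
def IsSquareIntegrableRep (π : Γ → H ≃ₗᵢ[ℂ] H) : Prop :=
  ∃ D : Submodule ℂ H, Dense (D : Set H) ∧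
    ∀ f : H, ∀ g ∈ D, Summable fun γ : Γ => ‖⟪f, π γ g⟫‖ ^ 2

/-- The commutant `π(Γ)'`. -/
def RepCommutant (π : Γ → H ≃ₗᵢ[ℂ] H) : Set (H →L[ℂ] H) :=
  {T | ∀ (γ : Γ) (f : H), T (π γ f) = π γ (T f)}

/-- The double commutant `π(Γ)''`. -/
def RepBicommutant (π : Γ → H ≃ₗᵢ[ℂ] H) : Set (H →L[ℂ] H) :=
  {T | ∀ S ∈ RepCommutant π, ∀ f : H, T (S f) = S (T f)}

/-- `h` is separating for `π(Γ)''`. -/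
def IsSeparatingVector (π : Γ → H ≃ₗᵢ[ℂ] H) (h : H) : Prop :=
  ∀ T ∈ RepBicommutant π, T h = 0 → T = 0

/-- `(π γ g)_γ` is a Parseval frame for `H`. -/
def IsParsevalFrame (π : Γ → H ≃ₗᵢ[ℂ] H) (g : H) : Prop :=
  ∀ f : H, HasSum (fun γ : Γ => ‖⟪f, π γ g⟫‖ ^ 2) (‖f‖ ^ 2)

/-- `(π γ g)_γ` is a frame for `H`. -/
def IsFrame (π : Γ → H ≃ₗᵢ[ℂ] H) (g : H) : Prop :=
  ∃ A B : ℝ, 0 < A ∧ 0 < B ∧ ∀ f : H,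
    (Summable fun γ : Γ => ‖⟪f, π γ g⟫‖ ^ 2) ∧
      A * ‖f‖ ^ 2 ≤ (∑' γ : Γ, ‖⟪f, π γ g⟫‖ ^ 2) ∧
      (∑' γ : Γ, ‖⟪f, π γ g⟫‖ ^ 2) ≤ B * ‖f‖ ^ 2

/-- `(π γ g)_γ` is a Riesz sequence. -/
def IsRieszSequence (π : Γ → H ≃ₗᵢ[ℂ] H) (g : H) : Prop :=
  ∃ A B : ℝ, 0 < A ∧ 0 < B ∧ ∀ (s : Finset Γ) (c : Γ → ℂ),
    A * ∑ γ ∈ s, ‖c γ‖ ^ 2 ≤ ‖∑ γ ∈ s, c γ • π γ g‖ ^ 2 ∧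
      ‖∑ γ ∈ s, c γ • π γ g‖ ^ 2 ≤ B * ∑ γ ∈ s, ‖c γ‖ ^ 2

/-- `g` is cyclic: the orbit `π(Γ)g` has dense linear span. -/
def IsCyclicVector (π : Γ → H ≃ₗᵢ[ℂ] H) (g : H) : Prop :=
  Dense ((Submodule.span ℂ (Set.range fun γ : Γ => π γ g) : Submodule ℂ H) : Set H)

/-- `γ₀` is `σ`-regular. -/
def IsSigmaRegular (σ : Γ → Γ → ℂ) (γ₀ : Γ) : Prop :=
  ∀ γ : Γ, γ * γ₀ = γ₀ * γ → σ γ₀ γ = σ γ γ₀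

/-- Kleppner's condition for `(Γ, σ)`. -/
def KleppnerCondition (σ : Γ → Γ → ℂ) : Prop :=
  ∀ γ₀ : Γ, γ₀ ≠ 1 → IsSigmaRegular σ γ₀ →
    {x : Γ | ∃ γ : Γ, γ * γ₀ * γ⁻¹ = x}.Infinite

end Defs


section Part1

variable {Γ : Type*} [Group Γ] {H : Type*} [NormedAddCommGroup H] [InnerProductSpace ℂ H]

theorem aux_proj_comm [CompleteSpace H] (K : Submodule ℂ H) [K.HasOrthogonalProjection]
    (T T' : H → H) (hsub : ∀ x y, T (x - y) = T x - T y)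
    (hadj : ∀ x y, ⟪T x, y⟫ = ⟪x, T' y⟫)
    (h : ∀ x ∈ K, T x ∈ K) (h' : ∀ x ∈ K, T' x ∈ K) (x : H) :
    K.starProjection (T x) = T (K.starProjection x) := by
  symm
  refine (Submodule.eq_starProjection_of_mem_of_inner_eq_zero
    (h _ (Submodule.starProjection_apply_mem _ _)) ?_).symm
  intro w hw
  rw [← hsub, hadj]
  exact Submodule.starProjection_inner_eq_zero _ _ (h' w hw)

theorem aux_closure_inv (s : Set H) (T : H →L[ℂ] H)
    (h : ∀ x ∈ s, T x ∈ (Submodule.span ℂ s).topologicalClosure) :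
    ∀ x ∈ (Submodule.span ℂ s).topologicalClosure,
      T x ∈ (Submodule.span ℂ s).topologicalClosure := by
  have hc : IsClosed (((Submodule.span ℂ s).topologicalClosure.comap
      (T : H →ₗ[ℂ] H) : Submodule ℂ H) : Set H) :=
    (Submodule.isClosed_topologicalClosure _).preimage T.continuous
  have := Submodule.topologicalClosure_minimal (s := Submodule.span ℂ s) (t := _)
    (Submodule.span_le.2 (fun x hx => h x hx)) hc
  intro x hx
  exact this hx

theorem aux_subset_closure {s : Set H} {x : H} (h : x ∈ s) :
    x ∈ (Submodule.span ℂ s).topologicalClosure :=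
  Submodule.le_topologicalClosure _ (Submodule.subset_span h)

theorem aux_orth {s : Set H} {y : H} (h : ∀ x ∈ s, ⟪x, y⟫ = 0) :
    ∀ x ∈ (Submodule.span ℂ s).topologicalClosure, ⟪x, y⟫ = 0 := by
  have : (Submodule.span ℂ s).topologicalClosure ≤ (ℂ ∙ y)ᗮ := by
    refine Submodule.topologicalClosure_minimal _ (Submodule.span_le.2 ?_)
      (Submodule.isClosed_orthogonal _)
    intro x hx
    exact Submodule.mem_orthogonal_singleton_iff_inner_left.2 (h x hx)
  intro x hx
  exact Submodule.mem_orthogonal_singleton_iff_inner_left.1 (this hx)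

variable {σ : Γ → Γ → ℂ} {π : Γ → H ≃ₗᵢ[ℂ] H}

theorem rep_symm (hrep : IsProjectiveRep σ π) (γ : Γ) (f : H) :
    (π γ).symm f = (σ γ γ⁻¹)⁻¹ • π γ⁻¹ f := by
  obtain ⟨h1, h2, h3, h4, h5⟩ := hrep
  have hne : σ γ γ⁻¹ ≠ 0 := by
    intro h; have := h1 γ γ⁻¹; rw [h] at this; simp at this
  rw [LinearIsometryEquiv.symm_apply_eq, map_smul, h5, smul_smul, inv_mul_cancel₀ hne]
  simp [h4]

theorem rep_adj (γ : Γ) (x y : H) : ⟪π γ x, y⟫ = ⟪x, (π γ).symm y⟫ := by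
  rw [← LinearIsometryEquiv.inner_map_map (π γ) x, LinearIsometryEquiv.apply_symm_apply]

theorem commutant_symm {S : H →L[ℂ] H} (hS : S ∈ RepCommutant π) (γ : Γ) (f : H) :
    S ((π γ).symm f) = (π γ).symm (S f) := by
  rw [LinearIsometryEquiv.eq_symm_apply, ← hS, LinearIsometryEquiv.apply_symm_apply]

theorem commutant_adjoint [CompleteSpace H] {S : H →L[ℂ] H} (hS : S ∈ RepCommutant π) :
    ContinuousLinearMap.adjoint S ∈ RepCommutant π := by
  intro γ f
  refine ext_inner_right ℂ fun y => ?_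
  rw [ContinuousLinearMap.adjoint_inner_left, rep_adj, rep_adj,
    ContinuousLinearMap.adjoint_inner_left, commutant_symm hS]

theorem commutant_comp {S T : H →L[ℂ] H} (hS : S ∈ RepCommutant π) (hT : T ∈ RepCommutant π) :
    S.comp T ∈ RepCommutant π := by
  intro γ f
  simp [hS γ, hT γ]

/-- the closed subspace generated by the orbits of elements of `F` -/
def orbU (π : Γ → H ≃ₗᵢ[ℂ] H) (F : Set H) : Submodule ℂ H :=
  (Submodule.span ℂ {x | ∃ γ, ∃ g ∈ F, π γ g = x}).topologicalClosure

/-- the closed subspace generated by the commutant orbits of elements of `F` -/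
def orbW (π : Γ → H ≃ₗᵢ[ℂ] H) (F : Set H) : Submodule ℂ H :=
  (Submodule.span ℂ {x | ∃ S ∈ RepCommutant π, ∃ g ∈ F, S g = x}).topologicalClosure

instance [CompleteSpace H] (F : Set H) : CompleteSpace (orbU π F) :=
  (Submodule.isClosed_topologicalClosure _).completeSpace_coe

instance [CompleteSpace H] (F : Set H) : CompleteSpace (orbW π F) :=
  (Submodule.isClosed_topologicalClosure _).completeSpace_coe

theorem orbU_inv (hrep : IsProjectiveRep σ π) (F : Set H) (γ : Γ) :
    ∀ x ∈ orbU π F, π γ x ∈ orbU π F := by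
  refine aux_closure_inv _ ((π γ).toContinuousLinearEquiv : H →L[ℂ] H) ?_
  rintro x ⟨γ', g, hg, rfl⟩
  have : π γ (π γ' g) = σ γ γ' • π (γ * γ') g := hrep.2.2.2.2 γ γ' g
  change π γ (π γ' g) ∈ _
  rw [this]
  exact Submodule.smul_mem _ _ (aux_subset_closure ⟨_, g, hg, rfl⟩)

theorem orbW_inv (F : Set H) {S : H →L[ℂ] H} (hS : S ∈ RepCommutant π) :
    ∀ x ∈ orbW π F, S x ∈ orbW π F := by
  refine aux_closure_inv _ S ?_
  rintro x ⟨T, hT, g, hg, rfl⟩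
  exact aux_subset_closure ⟨S.comp T, commutant_comp hS hT, g, hg, rfl⟩

theorem orbU_proj [CompleteSpace H] (hrep : IsProjectiveRep σ π) (F : Set H) :
    (orbU π F).starProjection ∈ RepCommutant π := by
  intro γ f
  refine aux_proj_comm _ (π γ) (π γ).symm (by simp) (rep_adj γ) (orbU_inv hrep F γ) ?_ f
  intro x hx
  rw [rep_symm hrep]
  exact Submodule.smul_mem _ _ (orbU_inv hrep F _ x hx)

theorem orbW_proj [CompleteSpace H] (F : Set H) {S : H →L[ℂ] H} (hS : S ∈ RepCommutant π)
    (f : H) : (orbW π F).starProjection (S f) = S ((orbW π F).starProjection f) :=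
  aux_proj_comm _ S (ContinuousLinearMap.adjoint S) (by simp)
    (fun x y => (ContinuousLinearMap.adjoint_inner_right S x y).symm) (orbW_inv F hS)
    (orbW_inv F (commutant_adjoint hS)) f

theorem mem_orbU (hrep : IsProjectiveRep σ π) {F : Set H} {g : H} (hg : g ∈ F) : g ∈ orbU π F :=
  aux_subset_closure ⟨1, g, hg, by simp [hrep.2.2.2.1]⟩

theorem mem_orbW {F : Set H} {g : H} (hg : g ∈ F) : g ∈ orbW π F :=
  aux_subset_closure ⟨ContinuousLinearMap.id ℂ H, by intro γ f; rfl, g, hg, rfl⟩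

/-- the orthogonality relation -/
def ORel (π : Γ → H ≃ₗᵢ[ℂ] H) (g h : H) : Prop :=
  (∀ γ, ⟪π γ g, h⟫ = 0) ∧ ∀ S ∈ RepCommutant π, ⟪S g, h⟫ = 0

theorem ORel.symm [CompleteSpace H] (hrep : IsProjectiveRep σ π) {g h : H} (H0 : ORel π g h) :
    ORel π h g := by
  refine ⟨fun γ => ?_, fun S hS => ?_⟩
  · rw [rep_adj, rep_symm hrep, inner_smul_right, inner_eq_zero_symm.1 (H0.1 γ⁻¹), mul_zero]
  · rw [← ContinuousLinearMap.adjoint_inner_right, inner_eq_zero_symm]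
    exact H0.2 _ (commutant_adjoint hS)

theorem aux_sum {F : Set H} {c : F → ℝ} {g : H}
    (hg : HasSum (fun i : F => (c i : ℂ) • (i : H)) g) (P : H →L[ℂ] H) (i : F)
    (h1 : P i = i) (h2 : ∀ j : F, j ≠ i → P j = 0) : P g = (c i : ℂ) • (i : H) := by
  have h3 : HasSum (fun j : F => P ((c j : ℂ) • (j : H))) (P g) := P.hasSum hg
  have h4 := hasSum_single (f := fun j : F => P ((c j : ℂ) • (j : H))) i
    (fun j hj => by simp [h2 j hj])
  simpa [h1] using h3.unique h4

/-- A family-maximality argument: the factor dichotomy. -/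
theorem dichotomy [CompleteSpace H] [TopologicalSpace.SeparableSpace H]
    (hrep : IsProjectiveRep σ π)
    (key : ∀ h1 h2 : H, (∀ S ∈ RepCommutant π, ∀ γ, ⟪S (π γ h1), h2⟫ = 0) → h1 = 0 ∨ h2 = 0) :
    (∃ g : H, IsCyclicVector π g) ∨ ∃ g : H, IsSeparatingVector π g := by
  obtain ⟨F, hF⟩ := zorn_subset
    {F : Set H | (∀ g ∈ F, ‖g‖ = 1) ∧ ∀ g ∈ F, ∀ h ∈ F, g ≠ h → ORel π g h} (by
      intro c hc hch
      refine ⟨⋃₀ c, ⟨?_, ?_⟩, fun s hs => Set.subset_sUnion_of_mem hs⟩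
      · rintro g ⟨s, hs, hg⟩
        exact (hc hs).1 g hg
      · rintro g ⟨s, hs, hg⟩ h ⟨t, ht, hh⟩ hne
        rcases hch.total hs ht with hst | hst
        · exact (hc ht).2 g (hst hg) h hh hne
        · exact (hc hs).2 g hg h (hst hh) hne)
  obtain ⟨⟨hF1, hF2⟩, hmax⟩ := hF
  have hcount : F.Countable := by
    refine Set.PairwiseDisjoint.countable_of_isOpen (s := fun x => Metric.ball x (1/2)) ?_
      (fun x _ => Metric.isOpen_ball) (fun x _ => ⟨x, by simp⟩)
    intro x hx y hy hne
    refine Metric.ball_disjoint_ball ?_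
    have h0 : ⟪x, y⟫ = 0 := by
      have := (hF2 x hx y hy hne).1 1
      simpa [hrep.2.2.2.1] using this
    have h1 := norm_sub_sq (𝕜 := ℂ) x y
    rw [h0, hF1 x hx, hF1 y hy] at h1
    simp at h1
    rw [dist_eq_norm]
    nlinarith [norm_nonneg (x - y)]
  have : Countable F := hcount.to_subtype
  obtain ⟨c, hcpos, C, hcC, -⟩ := NNReal.exists_pos_sum_of_countable (one_ne_zero) F
  have hsum : Summable (fun i : F => (((c i : ℝ)) : ℂ) • (i : H)) := by
    refine Summable.of_norm ?_
    have : Summable (fun i => (c i : ℝ)) := NNReal.summable_coe.2 hcC.summable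
    refine this.congr fun i => ?_
    rw [norm_smul, hF1 i i.2]; simp
  obtain ⟨g, hg⟩ := hsum
  have hc0 : ∀ i, ((c i : ℝ) : ℂ) ≠ 0 := fun i => by
    have := (hcpos i).ne'
    exact_mod_cast this
  -- projection computations
  have hU : ∀ i : F, (orbU π {(i : H)}).starProjection g = ((c i : ℝ) : ℂ) • (i : H) := by
    intro i
    refine aux_sum hg _ i ?_ ?_
    · exact Submodule.starProjection_eq_self_iff.2 (mem_orbU hrep rfl)
    · intro j hj
      rw [Submodule.starProjection_apply_eq_zero_iff, Submodule.mem_orthogonal]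
      refine aux_orth ?_
      rintro x ⟨γ, g, rfl, rfl⟩
      exact (hF2 i i.2 j j.2 (fun h => hj (Subtype.ext h.symm))).1 γ
  have hW : ∀ i : F, (orbW π {(i : H)}).starProjection g = ((c i : ℝ) : ℂ) • (i : H) := by
    intro i
    refine aux_sum hg _ i ?_ ?_
    · exact Submodule.starProjection_eq_self_iff.2 (mem_orbW rfl)
    · intro j hj
      rw [Submodule.starProjection_apply_eq_zero_iff, Submodule.mem_orthogonal]
      refine aux_orth ?_
      rintro x ⟨S, hS, g, rfl, rfl⟩
      exact (hF2 i i.2 j j.2 (fun h => hj (Subtype.ext h.symm))).2 S hS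
  by_cases hUt : orbU π F = ⊤
  · left
    refine ⟨g, ?_⟩
    have hmem : ∀ i : F, (i : H) ∈ orbU π {g} := by
      intro i
      have h1 := orbW_proj {(i : H)} (orbU_proj hrep {g}) g
      rw [Submodule.starProjection_eq_self_iff.2 (mem_orbU hrep (F := {g}) rfl), hW] at h1
      have h2 : ((c i : ℝ) : ℂ) • (i : H) ∈ orbU π {g} := by
        rw [h1]; exact Submodule.starProjection_apply_mem _ _
      exact (Submodule.smul_mem_iff _ (hc0 i)).1 h2
    have hle : orbU π F ≤ orbU π {g} := by
      refine Submodule.topologicalClosure_minimal _ (Submodule.span_le.2 ?_)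
        (Submodule.isClosed_topologicalClosure _)
      rintro x ⟨γ, y, hy, rfl⟩
      exact orbU_inv hrep _ _ _ (hmem ⟨y, hy⟩)
    rw [hUt, top_le_iff] at hle
    have hset : {x | ∃ γ, ∃ y ∈ ({g} : Set H), π γ y = x} = Set.range fun γ => π γ g := by
      ext x; simp
    rw [orbU, hset] at hle
    exact Submodule.dense_iff_topologicalClosure_eq_top.2 hle
  by_cases hWt : orbW π F = ⊤
  · right
    refine ⟨g, fun T hT hTg => ?_⟩
    have hTi : ∀ i : F, T i = 0 := by
      intro i
      have h1 := hT _ (orbU_proj hrep {(i : H)}) g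
      rw [hTg, hU, map_zero, map_smul] at h1
      exact (smul_eq_zero.1 h1).resolve_left (hc0 i)
    have hle : orbW π F ≤ LinearMap.ker (T : H →ₗ[ℂ] H) := by
      refine Submodule.topologicalClosure_minimal _ (Submodule.span_le.2 ?_)
        (ContinuousLinearMap.isClosed_ker T)
      rintro x ⟨S, hS, y, hy, rfl⟩
      have := hT S hS y
      simp only [SetLike.mem_coe, LinearMap.mem_ker, ContinuousLinearMap.coe_coe]
      rw [this, hTi ⟨y, hy⟩, map_zero]
    ext x
    have : x ∈ orbW π F := by rw [hWt]; trivial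
    exact hle this
  exfalso
  obtain ⟨h1, hh1, hh1'⟩ := (Submodule.ne_bot_iff _).1
    (fun h => hUt ((Submodule.orthogonal_eq_bot_iff).1 h))
  obtain ⟨h2, hh2, hh2'⟩ := (Submodule.ne_bot_iff _).1
    (fun h => hWt ((Submodule.orthogonal_eq_bot_iff).1 h))
  -- the maximality contradiction
  have hno : ∀ x ∈ (orbU π F)ᗮ, x ∈ (orbW π F)ᗮ → x = 0 := by
    intro x hxU hxW
    by_contra hx
    set y : H := ((‖x‖⁻¹ : ℝ) : ℂ) • x with hy
    have hyU : y ∈ (orbU π F)ᗮ := Submodule.smul_mem _ _ hxU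
    have hyW : y ∈ (orbW π F)ᗮ := Submodule.smul_mem _ _ hxW
    have hy1 : ‖y‖ = 1 := by
      rw [hy, norm_smul]
      simp [hx]
    have hrel : ∀ g ∈ F, ORel π g y := by
      intro g hg
      refine ⟨fun γ => ?_, fun S hS => ?_⟩
      · exact (Submodule.mem_orthogonal _ _).1 hyU _ (aux_subset_closure ⟨γ, g, hg, rfl⟩)
      · exact (Submodule.mem_orthogonal _ _).1 hyW _ (aux_subset_closure ⟨S, hS, g, hg, rfl⟩)
    have hyF : y ∈ F := by
      refine hmax (y := insert y F) ⟨?_, ?_⟩ (Set.subset_insert _ _) (Set.mem_insert _ _)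
      · rintro g (rfl | hg)
        · exact hy1
        · exact hF1 g hg
      · rintro g (rfl | hg) h (rfl | hh) hne
        · exact absurd rfl hne
        · exact (hrel h hh).symm hrep
        · exact hrel g hg
        · exact hF2 g hg h hh hne
    have h0 := (hrel y hyF).1 1
    simp only [hrep.2.2.2.1, LinearIsometryEquiv.coe_refl, id, inner_self_eq_zero] at h0
    rw [h0] at hy1
    simp at hy1
  have hWall : ∀ x ∈ (orbU π F)ᗮ, x - (orbW π F).starProjection x = 0 := by
    intro x hx
    refine hno _ ?_ (Submodule.sub_starProjection_mem_orthogonal x)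
    refine Submodule.sub_mem _ hx ?_
    rw [← Submodule.starProjection_apply_eq_zero_iff,
      ← orbW_proj F (orbU_proj hrep F), (Submodule.starProjection_apply_eq_zero_iff _).2 hx, map_zero]
  have := key h1 h2 (by
    intro S hS γ
    have hx : π γ h1 ∈ (orbU π F)ᗮ := by
      rw [← Submodule.starProjection_apply_eq_zero_iff, orbU_proj hrep F,
        (Submodule.starProjection_apply_eq_zero_iff _).2 hh1, map_zero]
    have h3 : π γ h1 ∈ orbW π F := by
      rw [← Submodule.starProjection_eq_self_iff]
      exact (sub_eq_zero.1 (hWall _ hx)).symm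
    exact (Submodule.mem_orthogonal _ _).1 hh2 _ (orbW_inv F hS _ h3))
  tauto

end Part1

section Part2

variable {Γ : Type*} {H : Type*} [NormedAddCommGroup H] [InnerProductSpace ℂ H]

theorem mem_l2 {f : Γ → ℂ} (hf : Summable fun x => ‖f x‖ ^ 2) :
    Memℓp (E := fun _ : Γ => ℂ) f 2 := by
  refine memℓp_gen ?_
  simpa using hf

theorem l2_summable (f : lp (fun _ : Γ => ℂ) 2) : Summable fun x => ‖f x‖ ^ 2 := by
  have := (lp.memℓp f).summable (by simp)
  simpa using this

/-- monomial isometries of `ℓ²` -/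
def monoIso (p : Γ → ℂ) (hp : ∀ x, ‖p x‖ = 1) (s : Γ ≃ Γ) :
    lp (fun _ : Γ => ℂ) 2 →ₗᵢ[ℂ] lp (fun _ : Γ => ℂ) 2 :=
  LinearMap.isometryOfInner
    { toFun := fun f => ⟨fun x => p x * f (s x), mem_l2 (by
        have := (Equiv.summable_iff s).2 (l2_summable f)
        refine this.congr fun x => ?_
        simp [hp])⟩
      map_add' := fun f g => by
        ext x; exact mul_add _ _ _
      map_smul' := fun c f => by
        ext x; simp; ring }
    (fun f g => by
      rw [lp.inner_eq_tsum, lp.inner_eq_tsum, ← Equiv.tsum_eq s (fun i => ⟪f i, g i⟫)]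
      refine tsum_congr fun x => ?_
      have h : (starRingEnd ℂ) (p x) * p x = 1 := by
        rw [mul_comm, Complex.mul_conj, Complex.normSq_eq_norm_sq, hp]; simp
      simp only [LinearMap.coe_mk, AddHom.coe_mk, RCLike.inner_apply, map_mul]
      linear_combination (g (s x) * (starRingEnd ℂ) (f (s x))) * h)

theorem monoIso_apply (p : Γ → ℂ) (hp : ∀ x, ‖p x‖ = 1) (s : Γ ≃ Γ)
    (f : lp (fun _ : Γ => ℂ) 2) (x : Γ) : monoIso p hp s f x = p x * f (s x) := rfl

/-- square summable coefficients -/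
def SqVec (π : Γ → H ≃ₗᵢ[ℂ] H) (g : H) : Prop :=
  ∀ f : H, Summable fun γ : Γ => ‖⟪f, π γ g⟫‖ ^ 2

/-- the coefficient map as a linear map -/
def coefLin (π : Γ → H ≃ₗᵢ[ℂ] H) (g : H) (hg : SqVec π g) :
    H →ₗ[ℂ] lp (fun _ : Γ => ℂ) 2 where
  toFun f := ⟨fun x => ⟪π x g, f⟫, mem_l2 (by
    refine (hg f).congr fun x => ?_
    rw [norm_inner_symm])⟩
  map_add' f f' := by ext x; exact inner_add_right _ _ _
  map_smul' c f := by ext x; exact inner_smul_right _ _ _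

theorem l2_apply_tendsto {u : ℕ → lp (fun _ : Γ => ℂ) 2} {y : lp (fun _ : Γ => ℂ) 2}
    (h : Filter.Tendsto u Filter.atTop (nhds y)) (x : Γ) :
    Filter.Tendsto (fun n => u n x) Filter.atTop (nhds (y x)) := by
  rw [tendsto_iff_norm_sub_tendsto_zero] at h ⊢
  refine squeeze_zero (fun _ => norm_nonneg _) (fun n => ?_) h
  exact lp.norm_apply_le_norm (by simp) (u n - y) x

/-- the coefficient map as a bounded operator -/
def coefL [CompleteSpace H] (π : Γ → H ≃ₗᵢ[ℂ] H) (g : H) (hg : SqVec π g) :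
    H →L[ℂ] lp (fun _ : Γ => ℂ) 2 where
  toLinearMap := coefLin π g hg
  cont := by
    refine LinearMap.continuous_of_seq_closed_graph _ fun u x y hu hy => ?_
    ext γ
    have h1 := l2_apply_tendsto hy γ
    have h2 : Filter.Tendsto (fun n => ⟪π γ g, u n⟫) Filter.atTop (nhds ⟪π γ g, x⟫) :=
      Filter.Tendsto.inner tendsto_const_nhds hu
    exact tendsto_nhds_unique h1 h2

theorem coefL_apply [CompleteSpace H] (π : Γ → H ≃ₗᵢ[ℂ] H) (g : H) (hg : SqVec π g) (f : H)
    (x : Γ) : coefL π g hg f x = ⟪π x g, f⟫ := rfl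

variable [Group Γ] {σ : Γ → Γ → ℂ} {π : Γ → H ≃ₗᵢ[ℂ] H}

theorem sig_conj (hrep : IsProjectiveRep σ π) (x y : Γ) :
    (starRingEnd ℂ) (σ x y) * σ x y = 1 := by
  rw [mul_comm, Complex.mul_conj, Complex.normSq_eq_norm_sq, hrep.1]; simp

theorem SqVec.rep (hrep : IsProjectiveRep σ π) {g : H} (hg : SqVec π g) (γ : Γ) :
    SqVec π (π γ g) := by
  intro f
  refine ((Equiv.summable_iff (Equiv.mulRight γ)).2 (hg f)).congr fun x => ?_
  rw [hrep.2.2.2.2, inner_smul_right, norm_mul, hrep.1, one_mul]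
  rfl

theorem SqVec.smul {g : H} (hg : SqVec π g) (c : ℂ) : SqVec π (c • g) := by
  intro f
  refine ((hg f).mul_left (‖c‖ ^ 2)).congr fun x => ?_
  rw [map_smul, inner_smul_right, norm_mul, mul_pow]

theorem SqVec.symm_rep (hrep : IsProjectiveRep σ π) {g : H} (hg : SqVec π g) (γ : Γ) :
    SqVec π ((π γ).symm g) := by
  rw [rep_symm hrep]
  exact (hg.rep hrep _).smul _

/-- the phase of the conjugation operator -/
def phase (σ : Γ → Γ → ℂ) (γ x : Γ) : ℂ :=
  (starRingEnd ℂ) (σ x γ) * σ γ (γ⁻¹ * x * γ)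

theorem phase_norm (hrep : IsProjectiveRep σ π) (γ x : Γ) : ‖phase σ γ x‖ = 1 := by
  simp [phase, hrep.1]

/-- conjugation operators -/
def conjOp (hrep : IsProjectiveRep σ π) (γ : Γ) :
    lp (fun _ : Γ => ℂ) 2 →ₗᵢ[ℂ] lp (fun _ : Γ => ℂ) 2 :=
  monoIso (phase σ γ) (phase_norm hrep γ) (MulAut.conj γ⁻¹).toEquiv

theorem conjOp_apply (hrep : IsProjectiveRep σ π) (γ : Γ) (f : lp (fun _ : Γ => ℂ) 2) (x : Γ) :
    conjOp hrep γ f x = phase σ γ x * f (γ⁻¹ * x * γ) := by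
  simp [conjOp, monoIso_apply]

theorem conjOp_coef [CompleteSpace H] (hrep : IsProjectiveRep σ π) (γ : Γ) (g f : H)
    (hg : SqVec π g) (hg' : SqVec π (π γ g)) :
    conjOp hrep γ (coefL π g hg f) = coefL π (π γ g) hg' (π γ f) := by
  ext x
  rw [conjOp_apply, coefL_apply, coefL_apply]
  have h1 := hrep.2.2.2.2 γ (γ⁻¹ * x * γ) g
  have h2 : γ * (γ⁻¹ * x * γ) = x * γ := by group
  rw [h2] at h1
  have h3 : ⟪π γ (π (γ⁻¹ * x * γ) g), π γ f⟫ = ⟪π (γ⁻¹ * x * γ) g, f⟫ :=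
    LinearIsometryEquiv.inner_map_map _ _ _
  rw [h1, inner_smul_left] at h3
  rw [hrep.2.2.2.2, inner_smul_left, ← h3, phase]
  linear_combination ((starRingEnd ℂ) (σ x γ) * ⟪π (x * γ) g, π γ f⟫) *
    sig_conj hrep γ (γ⁻¹ * x * γ)

theorem frame_mem [CompleteSpace H] (hrep : IsProjectiveRep σ π) (g g' : H)
    (hg : SqVec π g) (hg' : SqVec π g') :
    (ContinuousLinearMap.adjoint (coefL π g' hg')).comp (coefL π g hg) ∈ RepCommutant π := by
  intro γ f
  refine ext_inner_left ℂ fun y => ?_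
  have hadj : ∀ z, ⟪y, π γ z⟫ = ⟪(π γ).symm y, z⟫ := fun z => by
    rw [← LinearIsometryEquiv.inner_map_map (π γ) ((π γ).symm y),
      LinearIsometryEquiv.apply_symm_apply]
  rw [hadj]
  simp only [ContinuousLinearMap.comp_apply, ContinuousLinearMap.adjoint_inner_right]
  rw [lp.inner_eq_tsum, lp.inner_eq_tsum, ← Equiv.tsum_eq (Equiv.mulLeft γ)]
  refine tsum_congr fun x => ?_
  simp only [coefL_apply, Equiv.coe_mulLeft, RCLike.inner_apply]
  have h1 := hrep.2.2.2.2 γ x g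
  have h2 := hrep.2.2.2.2 γ x g'
  have h3 : ⟪π x g, f⟫ = ⟪π γ (π x g), π γ f⟫ :=
    (LinearIsometryEquiv.inner_map_map _ _ _).symm
  rw [h3, ← rep_adj, h1, h2, inner_smul_left, inner_smul_left, map_mul, Complex.conj_conj]
  linear_combination (-(⟪π (γ * x) g, π γ f⟫ * (starRingEnd ℂ) ⟪π (γ * x) g', y⟫)) *
    sig_conj hrep γ x

/-- invariant vectors of the conjugation operators are multiples of `δ_e` -/
theorem kleppner_fixed (hrep : IsProjectiveRep σ π) (hK : KleppnerCondition σ)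
    (ξ : lp (fun _ : Γ => ℂ) 2) (hξ : ∀ γ, conjOp hrep γ ξ = ξ) (x : Γ) (hx : x ≠ 1) :
    ξ x = 0 := by
  by_contra h0
  have hfix : ∀ γ y, ξ y = phase σ γ y * ξ (γ⁻¹ * y * γ) := fun γ y => by
    rw [← conjOp_apply hrep, hξ]
  have hreg : IsSigmaRegular σ x := by
    intro γ hγ
    have h1 := hfix γ x
    have h2 : γ⁻¹ * x * γ = x := by rw [mul_assoc, ← hγ]; group
    rw [phase, h2] at h1
    have h3 : (starRingEnd ℂ) (σ x γ) * σ γ x = 1 := by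
      apply mul_right_cancel₀ h0
      rw [← h1, one_mul]
    linear_combination (-(σ x γ)) * h3 + σ γ x * sig_conj hrep x γ
  refine hK x hx hreg ?_
  have hsum := l2_summable ξ
  have hfin : {y | ‖ξ x‖ ^ 2 ≤ ‖ξ y‖ ^ 2}.Finite := by
    have := hsum.tendsto_cofinite_zero.eventually (gt_mem_nhds (by positivity : 0 < ‖ξ x‖ ^ 2))
    rw [Filter.eventually_cofinite] at this
    simpa using this
  refine hfin.subset ?_
  rintro y ⟨γ, rfl⟩
  have h1 := hfix γ (γ * x * γ⁻¹)
  have h2 : γ⁻¹ * (γ * x * γ⁻¹) * γ = x := by group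
  rw [h2] at h1
  change ‖ξ x‖ ^ 2 ≤ ‖ξ (γ * x * γ⁻¹)‖ ^ 2
  rw [h1, norm_mul, phase_norm hrep, one_mul]

theorem key_lemma [CompleteSpace H] (hrep : IsProjectiveRep σ π)
    (hsq : IsSquareIntegrableRep π) (hK : KleppnerCondition σ) (h1 h2 : H)
    (h : ∀ S ∈ RepCommutant π, ∀ γ, ⟪S (π γ h1), h2⟫ = 0) : h1 = 0 ∨ h2 = 0 := by
  classical
  obtain ⟨D, hD, hDs⟩ := hsq
  let N : H → Prop := fun f => ∀ S ∈ RepCommutant π, ∀ γ, ⟪S (π γ f), h2⟫ = 0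
  have hN1 : ∀ f γ, N f → N (π γ f) := by
    intro f γ hf S hS γ'
    rw [hrep.2.2.2.2, map_smul, inner_smul_left, hf S hS, mul_zero]
  have hN2 : ∀ f γ, N f → N ((π γ).symm f) := by
    intro f γ hf S hS γ'
    rw [rep_symm hrep, map_smul, map_smul, inner_smul_left, hN1 f _ hf S hS, mul_zero]
  let s : Set (lp (fun _ : Γ => ℂ) 2) :=
    {v | ∃ g, ∃ hg : SqVec π g, ∃ f, N f ∧ coefL π g hg f = v}
  let V : Submodule ℂ (lp (fun _ : Γ => ℂ) 2) := (Submodule.span ℂ s).topologicalClosure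
  have : CompleteSpace V := (Submodule.isClosed_topologicalClosure _).completeSpace_coe
  let δ : lp (fun _ : Γ => ℂ) 2 := lp.single 2 (1 : Γ) (1 : ℂ)
  have hδ : ∀ v : lp (fun _ : Γ => ℂ) 2, ⟪δ, v⟫ = v 1 := by
    intro v
    rw [lp.inner_single_left]; simp
  have hVinv : ∀ γ, ∀ v ∈ V, conjOp hrep γ v ∈ V := by
    intro γ
    refine aux_closure_inv s (conjOp hrep γ).toContinuousLinearMap ?_
    rintro v ⟨g, hg, f, hf, rfl⟩
    exact aux_subset_closure ⟨π γ g, hg.rep hrep γ, π γ f, hN1 f γ hf,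
      (conjOp_coef hrep γ g f hg _).symm⟩
  have hVsurj : ∀ γ, ∀ v ∈ s, ∃ w ∈ V, conjOp hrep γ w = v := by
    rintro γ v ⟨g, hg, f, hf, rfl⟩
    refine ⟨_, aux_subset_closure ⟨(π γ).symm g, hg.symm_rep hrep γ, (π γ).symm f,
      hN2 f γ hf, rfl⟩, ?_⟩
    rw [conjOp_coef hrep γ _ _ _ ((hg.symm_rep hrep γ).rep hrep γ)]
    ext x
    simp only [coefL_apply, LinearIsometryEquiv.apply_symm_apply]
  have hδfix : ∀ γ, conjOp hrep γ δ = δ := by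
    intro γ
    ext x
    rw [conjOp_apply]
    by_cases hx : x = 1
    · subst hx
      have : γ⁻¹ * 1 * γ = 1 := by group
      rw [phase, this, (hrep.2.2.1 γ).1, (hrep.2.2.1 γ).2]
      simp
    · have hx' : γ⁻¹ * x * γ ≠ 1 := by
        intro h'
        apply hx
        have : x = γ * (γ⁻¹ * x * γ) * γ⁻¹ := by group
        rw [this, h']; group
      simp [δ, lp.single_apply, hx, hx']
  let ξ := V.starProjection δ
  have hξV : ξ ∈ V := Submodule.starProjection_apply_mem _ _
  have hξfix : ∀ γ, conjOp hrep γ ξ = ξ := by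
    intro γ
    refine (Submodule.eq_starProjection_of_mem_of_inner_eq_zero (hVinv γ _ hξV) ?_).symm
    intro w hw
    rw [← inner_conj_symm]
    have : ⟪w, δ - conjOp hrep γ ξ⟫ = 0 := by
      refine aux_orth (s := s) ?_ w hw
      intro v hv
      obtain ⟨w, hw, rfl⟩ := hVsurj γ v hv
      rw [← hδfix γ, ← map_sub, LinearIsometry.inner_map_map, inner_eq_zero_symm]
      exact Submodule.starProjection_inner_eq_zero _ _ hw
    rw [this, map_zero]
  have hξ : ξ = ξ 1 • δ := by
    ext x
    by_cases hx : x = 1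
    · subst hx
      simp [δ]
    · rw [kleppner_fixed hrep hK ξ hξfix x hx]
      simp [δ, lp.single_apply, hx]
  have hdense : ∀ f : H, (∀ g, SqVec π g → ⟪g, f⟫ = 0) → f = 0 := by
    intro f hf
    exact hD.eq_zero_of_inner_left ℂ fun g hg => by
      rw [← inner_conj_symm, hf _ (fun f => hDs f _ hg), map_zero]
  have h11 : N h1 := h
  by_cases hc : ξ 1 = 0
  · left
    refine hdense _ fun g hg => ?_
    rw [hc, zero_smul] at hξ
    have h3 : δ ∈ Vᗮ := (Submodule.starProjection_apply_eq_zero_iff _).1 hξ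
    have h4 := (Submodule.mem_orthogonal' _ _).1 h3 _
      (aux_subset_closure (s := s) ⟨g, hg, h1, h11, rfl⟩)
    rw [hδ, coefL_apply] at h4
    simpa [hrep.2.2.2.1] using h4
  · right
    refine hdense _ fun g hg => ?_
    have h3 : δ ∈ V := by
      rw [hξ] at hξV
      exact (Submodule.smul_mem_iff _ hc).1 hξV
    have h4 : ⟪δ, coefL π g hg h2⟫ = 0 := by
      refine aux_orth (s := s) ?_ δ h3
      rintro v ⟨g', hg', f, hf, rfl⟩
      rw [← ContinuousLinearMap.adjoint_inner_left]
      have := hf _ (frame_mem hrep g' g hg' hg) 1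
      simpa [hrep.2.2.2.1] using this
    rw [hδ, coefL_apply] at h4
    simpa [hrep.2.2.2.1] using h4

end Part2

theorem stmt_19
    {Γ : Type*} [Group Γ] [Countable Γ]
    {H : Type*} [NormedAddCommGroup H] [InnerProductSpace ℂ H] [CompleteSpace H]
    [TopologicalSpace.SeparableSpace H]
    (σ : Γ → Γ → ℂ) (π : Γ → H ≃ₗᵢ[ℂ] H)
    (hrep : IsProjectiveRep σ π)
    (hsq : IsSquareIntegrableRep π)
    (hK : KleppnerCondition σ) :
    (∃ g : H, IsCyclicVector π g) ∨ ∃ g : H, IsSeparatingVector π g := by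
  exact dichotomy hrep (key_lemma hrep hsq hK)
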